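/- Let 0<p≤q<∞, let N∈ℕ, let σ_1 ≥ σ_2 ≥ … ≥ σ_N ≥ 0 be real numbers, and let 1 ≤ m ≤ N. Then (∑_{u=m}^{N} σ_u^q)^{1/q} ≤ m^{1/q−1/p} · (∑_{u=1}^{N} σ_u^p)^{1/p}. -/

import Mathlib

/-- tail estimate for nonincreasing nonnegative sequences: for
`0 < p ≤ q < ∞` and `σ_1 ≥ … ≥ σ_N ≥ 0`,
`(∑_{u=m}^{N} σ_u^q)^{1/q} ≤ m^{1/q - 1/p} · (∑_{u=1}^{N} σ_u^p)^{1/p}`. -/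
theorem tail_lq_le_lp (p q : ℝ) (hp : 0 < p) (hpq : p ≤ q) (N : ℕ)
    (σ : ℕ → ℝ) (hnonneg : ∀ u, 1 ≤ u → u ≤ N → 0 ≤ σ u)
    (hmono : ∀ u v, 1 ≤ u → u ≤ v → v ≤ N → σ v ≤ σ u)
    (m : ℕ) (hm : 1 ≤ m) (hmN : m ≤ N) :
    (∑ u ∈ Finset.Icc m N, σ u ^ q) ^ (1 / q)
      ≤ (m : ℝ) ^ (1 / q - 1 / p) * (∑ u ∈ Finset.Icc 1 N, σ u ^ p) ^ (1 / p) := by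
  have hq : 0 < q := hp.trans_le hpq
  have hqp : 0 ≤ (q - p) / p := div_nonneg (sub_nonneg.2 hpq) hp.le
  have hm0 : (0 : ℝ) < m := by exact_mod_cast hm
  have hσm : 0 ≤ σ m := hnonneg m hm hmN
  have hterm : ∀ u ∈ Finset.Icc 1 N, 0 ≤ σ u ^ p := fun u hu =>
    Real.rpow_nonneg (hnonneg u (Finset.mem_Icc.1 hu).1 (Finset.mem_Icc.1 hu).2) p
  set S : ℝ := ∑ u ∈ Finset.Icc 1 N, σ u ^ p with hS
  have hS0 : 0 ≤ S := Finset.sum_nonneg hterm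
  have hhead : m * σ m ^ p ≤ S := calc
    m * σ m ^ p = ∑ _u ∈ Finset.Icc 1 m, σ m ^ p := by simp
    _ ≤ ∑ u ∈ Finset.Icc 1 m, σ u ^ p := Finset.sum_le_sum fun u hu =>
      Real.rpow_le_rpow hσm
        (hmono u m (Finset.mem_Icc.1 hu).1 (Finset.mem_Icc.1 hu).2 hmN) hp.le
    _ ≤ S := Finset.sum_le_sum_of_subset_of_nonneg
      (Finset.Icc_subset_Icc_right hmN) fun u hu _ => hterm u hu
  have hpow : σ m ^ (q - p) ≤ (S / m) ^ ((q - p) / p) := calc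
    σ m ^ (q - p) = (σ m ^ p) ^ ((q - p) / p) := by
      rw [← Real.rpow_mul hσm, mul_div_cancel₀ _ hp.ne']
    _ ≤ (S / m) ^ ((q - p) / p) :=
      Real.rpow_le_rpow (Real.rpow_nonneg hσm p) ((le_div_iff₀' hm0).2 hhead) hqp
  have htail : ∑ u ∈ Finset.Icc m N, σ u ^ q ≤ σ m ^ (q - p) * S := calc
    ∑ u ∈ Finset.Icc m N, σ u ^ q
        ≤ ∑ u ∈ Finset.Icc m N, σ m ^ (q - p) * σ u ^ p := by
      refine Finset.sum_le_sum fun u hu => ?_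
      obtain ⟨hmu, huN⟩ := Finset.mem_Icc.1 hu
      have hu0 : 0 ≤ σ u := hnonneg u (hm.trans hmu) huN
      calc σ u ^ q = σ u ^ (q - p) * σ u ^ p := by
            rw [← Real.rpow_add_of_nonneg hu0 (sub_nonneg.2 hpq) hp.le, sub_add_cancel]
        _ ≤ σ m ^ (q - p) * σ u ^ p :=
            mul_le_mul_of_nonneg_right
              (Real.rpow_le_rpow hu0 (hmono m u hm hmu huN) (sub_nonneg.2 hpq))
              (Real.rpow_nonneg hu0 p)
    _ = σ m ^ (q - p) * ∑ u ∈ Finset.Icc m N, σ u ^ p := by rw [Finset.mul_sum]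
    _ ≤ σ m ^ (q - p) * S :=
      mul_le_mul_of_nonneg_left
        (Finset.sum_le_sum_of_subset_of_nonneg (Finset.Icc_subset_Icc_left hm)
          fun u hu _ => hterm u hu)
        (Real.rpow_nonneg hσm _)
  have hrhs : (S / m) ^ ((q - p) / p) * S
      = ((m : ℝ) ^ (1 / q - 1 / p) * S ^ (1 / p)) ^ q := by
    rw [Real.mul_rpow (Real.rpow_nonneg hm0.le _) (Real.rpow_nonneg hS0 _),
      ← Real.rpow_mul hm0.le, ← Real.rpow_mul hS0, Real.div_rpow hS0 hm0.le,
      show (1 / q - 1 / p) * q = -((q - p) / p) by field_simp; ring,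
      show 1 / p * q = (q - p) / p + 1 by field_simp; ring,
      Real.rpow_neg hm0.le, Real.rpow_add_of_nonneg hS0 hqp zero_le_one, Real.rpow_one]
    ring
  rw [one_div q, Real.rpow_inv_le_iff_of_pos _ _ hq, ← one_div q, ← hrhs]
  · exact htail.trans (mul_le_mul_of_nonneg_right hpow hS0)
  · exact Finset.sum_nonneg fun u hu => Real.rpow_nonneg
      (hnonneg u (hm.trans (Finset.mem_Icc.1 hu).1) (Finset.mem_Icc.1 hu).2) q
  · positivity
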